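/- arXiv:2307.07689 — 2 statements merged into one kernel-verified Lean document; each statement's English description precedes it below -/
import Mathlib

section
/- Let T > 0 and let G, Ĝ ∈ ℝ^{m×k} satisfy GᵀG = T·I_k and ĜᵀĜ = T·I_k. Let H ∈ ℝ^{k×k} and set E = Ĝ − GHᵀ. Then (i) HHᵀ − I_k = (1/T)·(EᵀE − EᵀĜ − ĜᵀE), and consequently ‖HHᵀ − I_k‖_F ≤ (‖E‖_F/√T)² + 2·‖E‖_F/√T; (ii) if moreover H is invertible, then HᵀH − I_k = Hᵀ(HHᵀ − I_k)(Hᵀ)^{−1}, and hence ‖HᵀH − I_k‖_F ≤ ‖H‖₂ · ‖HHᵀ − I_k‖_F · ‖H^{−1}‖₂. -/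
open Matrix

/-- The Frobenius norm of a real matrix. -/
noncomputable def frobNorm {m k : ℕ} (A : Matrix (Fin m) (Fin k) ℝ) : ℝ :=
  Real.sqrt (∑ i, ∑ j, (A i j) ^ 2)

/-- The operator (spectral) norm of a real matrix, i.e. the norm of the induced
continuous linear map between Euclidean spaces. -/
noncomputable def opNorm {m k : ℕ} (A : Matrix (Fin m) (Fin k) ℝ) : ℝ :=
  ‖LinearMap.toContinuousLinearMap (Matrix.toEuclideanLin A)‖

section Frobenius

open scoped Matrix.Norms.Frobenius

theorem frobNorm_eq_norm {m k : ℕ} (A : Matrix (Fin m) (Fin k) ℝ) : frobNorm A = ‖A‖ := by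
  simp [frobNorm, Matrix.frobenius_norm_def, Real.sqrt_eq_rpow]

theorem frobNorm_nonneg {m k : ℕ} (A : Matrix (Fin m) (Fin k) ℝ) : 0 ≤ frobNorm A :=
  Real.sqrt_nonneg _

theorem frobNorm_transpose {m k : ℕ} (A : Matrix (Fin m) (Fin k) ℝ) :
    frobNorm Aᵀ = frobNorm A := by
  simp only [frobNorm_eq_norm, Matrix.frobenius_norm_transpose]

theorem frobNorm_sub_le {m k : ℕ} (A B : Matrix (Fin m) (Fin k) ℝ) :
    frobNorm (A - B) ≤ frobNorm A + frobNorm B := by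
  simpa only [frobNorm_eq_norm] using norm_sub_le A B

theorem frobNorm_smul {m k : ℕ} (c : ℝ) (A : Matrix (Fin m) (Fin k) ℝ) :
    frobNorm (c • A) = |c| * frobNorm A := by
  simp only [frobNorm_eq_norm, norm_smul, Real.norm_eq_abs]

theorem frobNorm_mul_le {l m k : ℕ} (A : Matrix (Fin l) (Fin m) ℝ)
    (B : Matrix (Fin m) (Fin k) ℝ) : frobNorm (A * B) ≤ frobNorm A * frobNorm B := by
  simpa only [frobNorm_eq_norm] using Matrix.frobenius_norm_mul A B

end Frobenius

section Operator

open scoped Matrix.Norms.L2Operator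

theorem opNorm_eq_norm {m k : ℕ} (A : Matrix (Fin m) (Fin k) ℝ) : opNorm A = ‖A‖ :=
  rfl

theorem opNorm_nonneg {m k : ℕ} (A : Matrix (Fin m) (Fin k) ℝ) : 0 ≤ opNorm A :=
  norm_nonneg _

theorem opNorm_transpose {m k : ℕ} (A : Matrix (Fin m) (Fin k) ℝ) : opNorm Aᵀ = opNorm A := by
  rw [opNorm_eq_norm, opNorm_eq_norm, ← Matrix.conjTranspose_eq_transpose_of_trivial,
    Matrix.l2_opNorm_conjTranspose]

theorem opNorm_le_sqrt_of_transpose_mul_self {m k : ℕ} {T : ℝ} (hT : 0 ≤ T)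
    {A : Matrix (Fin m) (Fin k) ℝ} (hA : Aᵀ * A = T • (1 : Matrix (Fin k) (Fin k) ℝ)) :
    opNorm A ≤ √T := by
  apply Real.le_sqrt_of_sq_le
  rw [opNorm_eq_norm, sq, ← Matrix.l2_opNorm_conjTranspose_mul_self,
    Matrix.conjTranspose_eq_transpose_of_trivial, hA, Matrix.smul_one_eq_diagonal,
    Matrix.l2_opNorm_diagonal]
  exact (pi_norm_le_iff_of_nonneg hT).2 fun _ => (Real.norm_of_nonneg hT).le

theorem sum_sq_mulVec_le {m k : ℕ} (A : Matrix (Fin m) (Fin k) ℝ) (v : Fin k → ℝ) :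
    ∑ i, (A *ᵥ v) i ^ 2 ≤ opNorm A ^ 2 * ∑ j, v j ^ 2 := by
  have h := pow_le_pow_left₀ (norm_nonneg _) (Matrix.l2_opNorm_mulVec A (WithLp.toLp 2 v)) 2
  rw [mul_pow, EuclideanSpace.norm_sq_eq, EuclideanSpace.norm_sq_eq] at h
  simpa [opNorm_eq_norm] using h

end Operator

theorem frobNorm_mul_le_opNorm_mul {l m k : ℕ} (A : Matrix (Fin l) (Fin m) ℝ)
    (B : Matrix (Fin m) (Fin k) ℝ) : frobNorm (A * B) ≤ opNorm A * frobNorm B := by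
  apply Real.sqrt_le_iff.2 ⟨mul_nonneg (opNorm_nonneg A) (frobNorm_nonneg B), ?_⟩
  rw [mul_pow, frobNorm, Real.sq_sqrt (by positivity), Finset.sum_comm,
    Finset.sum_comm (f := fun i j => B i j ^ 2), Finset.mul_sum]
  exact Finset.sum_le_sum fun j _ => sum_sq_mulVec_le A fun i => B i j

theorem frobNorm_mul_le_mul_opNorm {l m k : ℕ} (A : Matrix (Fin l) (Fin m) ℝ)
    (B : Matrix (Fin m) (Fin k) ℝ) : frobNorm (A * B) ≤ frobNorm A * opNorm B := by
  rw [← frobNorm_transpose, Matrix.transpose_mul, mul_comm, ← opNorm_transpose B,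
    ← frobNorm_transpose A]
  exact frobNorm_mul_le_opNorm_mul _ _

/-- If `GᵀG = T·I` and `ĜᵀĜ = T·I` and `E = Ĝ − GHᵀ`, then
(i) `HHᵀ − I = (1/T)(EᵀE − EᵀĜ − ĜᵀE)`, whence
`‖HHᵀ − I‖_F ≤ (‖E‖_F/√T)² + 2‖E‖_F/√T`; and (ii) if `H` is invertible then
`HᵀH − I = Hᵀ(HHᵀ − I)(Hᵀ)⁻¹`, whence
`‖HᵀH − I‖_F ≤ ‖H‖₂ ‖HHᵀ − I‖_F ‖H⁻¹‖₂`. -/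
theorem rotation_matrix_asymptotically_orthogonal
    (m k : ℕ) (T : ℝ) (hT : 0 < T)
    (G Gh : Matrix (Fin m) (Fin k) ℝ)
    (hG : Gᵀ * G = T • (1 : Matrix (Fin k) (Fin k) ℝ))
    (hGh : Ghᵀ * Gh = T • (1 : Matrix (Fin k) (Fin k) ℝ))
    (H : Matrix (Fin k) (Fin k) ℝ)
    (E : Matrix (Fin m) (Fin k) ℝ) (hE : E = Gh - G * Hᵀ) :
    (H * Hᵀ - 1 = T⁻¹ • (Eᵀ * E - Eᵀ * Gh - Ghᵀ * E)
      ∧ frobNorm (H * Hᵀ - 1)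
          ≤ (frobNorm E / Real.sqrt T) ^ 2 + 2 * (frobNorm E / Real.sqrt T))
    ∧ (IsUnit H.det →
        Hᵀ * H - 1 = Hᵀ * (H * Hᵀ - 1) * (Hᵀ)⁻¹
        ∧ frobNorm (Hᵀ * H - 1) ≤ opNorm H * frobNorm (H * Hᵀ - 1) * opNorm H⁻¹) := by
  have hsq : T • (H * Hᵀ - 1) = Eᵀ * E - Eᵀ * Gh - Ghᵀ * E := by
    have h : (G * Hᵀ)ᵀ * (G * Hᵀ) = T • (H * Hᵀ) := by
      rw [Matrix.transpose_mul, Matrix.transpose_transpose, Matrix.mul_assoc,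
        ← Matrix.mul_assoc Gᵀ, hG, Matrix.smul_mul, Matrix.one_mul, Matrix.mul_smul]
    have hGH : G * Hᵀ = Gh - E := by rw [hE, sub_sub_cancel]
    rw [hGH, Matrix.transpose_sub, Matrix.sub_mul, Matrix.mul_sub, Matrix.mul_sub, hGh] at h
    rw [smul_sub, ← h]
    abel
  have hid : H * Hᵀ - 1 = T⁻¹ • (Eᵀ * E - Eᵀ * Gh - Ghᵀ * E) := by
    rw [← hsq, inv_smul_smul₀ hT.ne']
  refine ⟨⟨hid, ?_⟩, fun hH => ?_⟩
  · have hop := opNorm_le_sqrt_of_transpose_mul_self hT.le hGh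
    have hEE : frobNorm (Eᵀ * E) ≤ frobNorm E * frobNorm E := by
      simpa only [frobNorm_transpose] using frobNorm_mul_le Eᵀ E
    have hEG : frobNorm (Eᵀ * Gh) ≤ frobNorm E * √T := by
      refine (frobNorm_mul_le_mul_opNorm _ _).trans ?_
      rw [frobNorm_transpose]
      exact mul_le_mul_of_nonneg_left hop (frobNorm_nonneg E)
    have hGE : frobNorm (Ghᵀ * E) ≤ frobNorm E * √T := by
      rwa [← frobNorm_transpose, Matrix.transpose_mul, Matrix.transpose_transpose]
    have hs : 0 < √T := Real.sqrt_pos.2 hT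
    calc frobNorm (H * Hᵀ - 1)
        = T⁻¹ * frobNorm (Eᵀ * E - Eᵀ * Gh - Ghᵀ * E) := by
          rw [hid, frobNorm_smul, abs_of_pos (inv_pos.2 hT)]
      _ ≤ T⁻¹ * (frobNorm E * frobNorm E + frobNorm E * √T + frobNorm E * √T) := by
          gcongr
          linarith [frobNorm_sub_le (Eᵀ * E - Eᵀ * Gh) (Ghᵀ * E),
            frobNorm_sub_le (Eᵀ * E) (Eᵀ * Gh)]
      _ = (frobNorm E / √T) ^ 2 + 2 * (frobNorm E / √T) := by
          nth_rewrite 1 [← Real.sq_sqrt hT.le]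
          field_simp
          ring
  · have hHt : IsUnit (Hᵀ).det := by rwa [Matrix.det_transpose]
    have hconj : Hᵀ * H - 1 = Hᵀ * (H * Hᵀ - 1) * (Hᵀ)⁻¹ := by
      rw [Matrix.mul_sub, Matrix.sub_mul, Matrix.mul_one, Matrix.mul_nonsing_inv _ hHt,
        ← Matrix.mul_assoc, Matrix.mul_nonsing_inv_cancel_right _ _ hHt]
    refine ⟨hconj, ?_⟩
    rw [hconj, ← Matrix.transpose_nonsing_inv, ← opNorm_transpose H, ← opNorm_transpose H⁻¹]
    exact (frobNorm_mul_le_mul_opNorm _ _).trans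
      (mul_le_mul_of_nonneg_right (frobNorm_mul_le_opNorm_mul _ _) (opNorm_nonneg _))
end

section
/- Let β̂ be a Lasso estimator with penalty λ > 0 and suppose (2/T)·‖Xᵀe‖_∞ ≤ λ/2. Then the error Δ = β̂ − β* lies in the cone C₃(S), i.e., ‖Δ_{S^c}‖₁ ≤ 3·‖Δ_S‖₁, where S^c is the complement of S in {1,…,p}. -/
open Matrix

/-- The Euclidean norm of a vector in `ℝ^n`. -/
noncomputable def vnorm {n : ℕ} (v : Fin n → ℝ) : ℝ :=
  Real.sqrt (∑ i, (v i) ^ 2)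

/-- The ℓ₁-norm of a vector in `ℝ^n`. -/
def l1norm {n : ℕ} (v : Fin n → ℝ) : ℝ := ∑ i, |v i|

theorem vnorm_sq {n : ℕ} (v : Fin n → ℝ) : vnorm v ^ 2 = v ⬝ᵥ v := by
  rw [vnorm, Real.sq_sqrt (Finset.sum_nonneg fun i _ => sq_nonneg (v i))]
  simp only [dotProduct, sq]

/-- Hölder's inequality for the pairing of `ℓ_∞` with `ℓ₁`. -/
theorem dotProduct_le_iSup_abs_mul_l1norm {n : ℕ} (u v : Fin n → ℝ) :
    u ⬝ᵥ v ≤ (⨆ j, |u j|) * l1norm v := by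
  rw [dotProduct, l1norm, Finset.mul_sum]
  refine Finset.sum_le_sum fun j _ => (le_abs_self _).trans ?_
  rw [abs_mul]
  gcongr
  exact le_ciSup (f := fun j => |u j|) (Set.finite_range _).bddAbove j

theorem vnorm_sub_mulVec_sq_ge {m n : ℕ} (X : Matrix (Fin m) (Fin n) ℝ) (e : Fin m → ℝ)
    (v : Fin n → ℝ) :
    vnorm e ^ 2 - 2 * ((⨆ j, |(Xᵀ.mulVec e) j|) * l1norm v) ≤ vnorm (e - X.mulVec v) ^ 2 := by
  have hHolder := dotProduct_le_iSup_abs_mul_l1norm (Xᵀ.mulVec e) v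
  rw [mulVec_transpose, ← dotProduct_mulVec, ← mulVec_transpose] at hHolder
  have hnonneg : 0 ≤ X.mulVec v ⬝ᵥ X.mulVec v := vnorm_sq (X.mulVec v) ▸ sq_nonneg _
  rw [vnorm_sq, vnorm_sq, sub_dotProduct, dotProduct_sub, dotProduct_sub,
    dotProduct_comm (X.mulVec v) e]
  linarith

/-- Moving away from a vector supported on `S` raises the `ℓ₁`-norm by at least the off-support
mass minus the on-support mass of the displacement. -/
theorem l1norm_add_sum_compl_le {n : ℕ} (a b : Fin n → ℝ) (S : Finset (Fin n))
    (ha : ∀ j ∉ S, a j = 0) :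
    l1norm a + ∑ j ∈ Sᶜ, |(b - a) j| ≤ l1norm b + ∑ j ∈ S, |(b - a) j| := by
  rw [l1norm, l1norm, ← Finset.sum_add_sum_compl S fun j => |a j|,
    ← Finset.sum_add_sum_compl S fun j => |b j|]
  have hoff_a : ∑ j ∈ Sᶜ, |a j| = 0 :=
    Finset.sum_eq_zero fun j hj => by rw [ha j (Finset.mem_compl.mp hj), abs_zero]
  have hoff : ∑ j ∈ Sᶜ, |(b - a) j| = ∑ j ∈ Sᶜ, |b j| :=
    Finset.sum_congr rfl fun j hj => by
      rw [Pi.sub_apply, ha j (Finset.mem_compl.mp hj), sub_zero]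
  have hon : ∑ j ∈ S, |a j| ≤ ∑ j ∈ S, |b j| + ∑ j ∈ S, |(b - a) j| := by
    rw [← Finset.sum_add_distrib]
    refine Finset.sum_le_sum fun j _ => ?_
    rw [Pi.sub_apply, abs_sub_comm]
    linarith [abs_sub_abs_le_abs_sub (a j) (b j)]
  linarith

/-- **Lasso cone condition.** If `β̂` minimizes
`b ↦ (1/T)‖y − Xb‖² + λ‖b‖₁` where `y = Xβ* + e`, and `(2/T)‖Xᵀe‖_∞ ≤ λ/2`, then the
error `Δ = β̂ − β*` lies in the cone `C₃(S)`: `‖Δ_{Sᶜ}‖₁ ≤ 3‖Δ_S‖₁`, where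
`S = {j : β*_j ≠ 0}`. -/
theorem lasso_cone_condition
    (T p : ℕ) (hT : 0 < T) (hp : 0 < p)
    (X : Matrix (Fin T) (Fin p) ℝ) (βs : Fin p → ℝ) (e : Fin T → ℝ)
    (y : Fin T → ℝ) (hy : y = X.mulVec βs + e)
    (lam : ℝ) (hlam : 0 < lam)
    (βh : Fin p → ℝ)
    (hmin : ∀ b : Fin p → ℝ,
      (T : ℝ)⁻¹ * vnorm (y - X.mulVec βh) ^ 2 + lam * l1norm βh
        ≤ (T : ℝ)⁻¹ * vnorm (y - X.mulVec b) ^ 2 + lam * l1norm b)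
    -- (2/T)·‖Xᵀe‖_∞ ≤ λ/2
    (hnoise : (2 / (T : ℝ)) * (⨆ j, |(Xᵀ.mulVec e) j|) ≤ lam / 2)
    (S : Finset (Fin p)) (hS : ∀ j, j ∈ S ↔ βs j ≠ 0) :
    ∑ j ∈ Sᶜ, |(βh - βs) j| ≤ 3 * ∑ j ∈ S, |(βh - βs) j| := by
  have hbasic := hmin βs
  have hres : y - X.mulVec βh = e - X.mulVec (βh - βs) := by
    rw [hy, mulVec_sub]
    abel
  have hres_true : y - X.mulVec βs = e := by
    rw [hy, add_sub_cancel_left]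
  rw [hres, hres_true] at hbasic
  have hexpand := mul_le_mul_of_nonneg_left (vnorm_sub_mulVec_sq_ge X e (βh - βs))
    (inv_nonneg.mpr (Nat.cast_nonneg (α := ℝ) T))
  have hl1_nonneg : 0 ≤ l1norm (βh - βs) := Finset.sum_nonneg fun j _ => abs_nonneg _
  have hcross := mul_le_mul_of_nonneg_right hnoise hl1_nonneg
  have hsupport := mul_le_mul_of_nonneg_left
    (l1norm_add_sum_compl_le βs βh S fun j hj => by simpa using mt (hS j).mpr hj) hlam.le
  have hsplit : l1norm (βh - βs) = ∑ j ∈ S, |(βh - βs) j| + ∑ j ∈ Sᶜ, |(βh - βs) j| :=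
    (Finset.sum_add_sum_compl S _).symm
  rw [div_eq_mul_inv 2 (T : ℝ)] at hcross
  have hscaled : lam * (∑ j ∈ Sᶜ, |(βh - βs) j|) ≤ lam * (3 * ∑ j ∈ S, |(βh - βs) j|) := by
    rw [hsplit] at hcross hexpand
    linarith
  exact le_of_mul_le_mul_left hscaled hlam
end
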